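/- There exists a universal constant C > 0 with the following property. Let p ≥ 3, and suppose μ_o ∈ ℝᵖ, μ_o ≥ 0 coordinatewise, μ_o ≠ 0, satisfies R(μ_o) ≤ ε_o. Let 0 < ε₁ < 3/4, δ ∈ (0, 1/e], set λ = 2ε₁/(3‖μ_o‖₁), and let n ≥ C · ‖μ_o‖₁² ‖κ‖_∞² (√(log p) + √(log(1/δ)))² / ε₁⁴ be even. Then, with probability at least 1 − 2δ over an i.i.d. sample S ~ Dⁿ, any minimizer μ̂ of (λ/2)‖μ‖₁ + R̂_S(μ) over {μ ≥ 0} satisfies R(μ̂) ≤ ε_o + ε₁; that is, μ̂ is (ε_o + ε₁)-combination good. -/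

import Mathlib

open MeasureTheory Finset

noncomputable section

/-- The ±1 real value of a Boolean label: `true ↦ 1`, `false ↦ -1`.
We encode the label space {−1, 1} by `Bool`. -/
def sgn (b : Bool) : ℝ := if b then 1 else -1

/-- The Euclidean (L2) norm on ℝᵖ. -/
def l2norm {p : ℕ} (μ : Fin p → ℝ) : ℝ := Real.sqrt (∑ i, μ i ^ 2)

/-- The L1 norm on ℝᵖ. -/
def l1norm {p : ℕ} (μ : Fin p → ℝ) : ℝ := ∑ i, |μ i|

/-- The L∞ (supremum) norm on ℝᵖ. -/
def linfnorm {p : ℕ} (μ : Fin p → ℝ) : ℝ := ⨆ i, |μ i|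

/-- The standard inner product on ℝᵖ. -/
def ip {p : ℕ} (μ v : Fin p → ℝ) : ℝ := ∑ i, μ i * v i

/-- The K-space feature map `z(x,x') = (K₁(x,x'),…,K_p(x,x'))`. -/
def zmap {X : Type*} {p : ℕ} (K : Fin p → X → X → ℝ) (x x' : X) : Fin p → ℝ :=
  fun i => K i x x'

/-- The pairwise hinge loss `ℓ(μ, (x,y), (x',y')) = max(0, 1 − y y' ⟨μ, z(x,x')⟩)`. -/
def hinge {X : Type*} {p : ℕ} (K : Fin p → X → X → ℝ) (μ : Fin p → ℝ)
    (w w' : X × Bool) : ℝ :=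
  max 0 (1 - sgn w.2 * sgn w'.2 * ip μ (zmap K w.1 w'.1))

/-- The empirical risk `R̂_S(μ) = (2/(n(n−1))) Σ_{1≤i<j≤n} ℓ(μ, (xᵢ,yᵢ), (xⱼ,yⱼ))`. -/
def empRisk {X : Type*} {p n : ℕ} (K : Fin p → X → X → ℝ)
    (S : Fin n → X × Bool) (μ : Fin p → ℝ) : ℝ :=
  (2 / ((n : ℝ) * ((n : ℝ) - 1))) *
    ∑ i : Fin n, ∑ j : Fin n, if i < j then hinge K μ (S i) (S j) else 0

/-- The true risk `R(μ) = E_{((x,y),(x',y')) ~ D×D}[max(0, 1 − y y' ⟨μ, z(x,x')⟩)]`. -/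
def trueRisk {X : Type*} [MeasurableSpace X] {p : ℕ} (K : Fin p → X → X → ℝ)
    (D : Measure (X × Bool)) (μ : Fin p → ℝ) : ℝ :=
  ∫ w, hinge K μ w.1 w.2 ∂(D.prod D)

/-- Expectation over m i.i.d. Rademacher random variables (uniform on {−1,+1}),
encoded by Booleans mapped to ±1 via `sgn`. -/
def radE {m : ℕ} (f : (Fin m → Bool) → ℝ) : ℝ :=
  (∑ ε : Fin m → Bool, f ε) / 2 ^ m

lemma sgn_true : sgn true = 1 := by simp [sgn]

lemma sgn_false : sgn false = -1 := by simp [sgn]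

/-- A two-point majorization inequality for the exponential. -/
lemma exp_add_exp_le {a b M N : ℝ} (ha : a ≤ max M N) (hb : b ≤ max M N)
    (hs : a + b ≤ M + N) : Real.exp a + Real.exp b ≤ Real.exp M + Real.exp N := by
  wlog hab : b ≤ a generalizing a b
  · have := this hb ha (by linarith) (by linarith)
    linarith
  wlog hMN : N ≤ M generalizing M N
  · have := this (by rwa [max_comm]) (by rwa [max_comm]) (by linarith) (by linarith)
    linarith
  rw [max_eq_left hMN] at ha hb
  by_cases hbN : b ≤ N
  · exact add_le_add (Real.exp_le_exp.2 ha) (Real.exp_le_exp.2 hbN)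
  push Not at hbN
  have tangent : ∀ x y : ℝ, Real.exp x * (y - x) ≤ Real.exp y - Real.exp x := by
    intro x y
    have h1 := Real.add_one_le_exp (y - x)
    have h2 : Real.exp y = Real.exp x * Real.exp (y - x) := by
      rw [← Real.exp_add]; congr 1; ring
    rw [h2]
    nlinarith [Real.exp_pos x]
  have h1 := tangent a M
  have h2 := tangent b N
  have h3 : Real.exp b ≤ Real.exp a := Real.exp_le_exp.2 hab
  have h4 : Real.exp a * (b - N) ≤ Real.exp a * (M - a) :=
    mul_le_mul_of_nonneg_left (by linarith) (Real.exp_pos a).le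
  have h5 : Real.exp b * (b - N) ≤ Real.exp a * (b - N) :=
    mul_le_mul_of_nonneg_right h3 (by linarith)
  linarith

/-- One-coordinate contraction: replacing `v` by `w` with larger increments increases the
exponential moment of the supremum of a one-sign Rademacher process. -/
lemma exp_sup_contraction_step {α : Type*} {T : Finset α} (hT : T.Nonempty) (A v w : α → ℝ)
    (hvw : ∀ s t, |v s - v t| ≤ |w s - w t|) (hv : ∀ s, |v s| ≤ |w s|) :
    Real.exp (T.sup' hT fun s => A s + v s) + Real.exp (T.sup' hT fun s => A s - v s) ≤
      Real.exp (T.sup' hT fun s => A s + w s) + Real.exp (T.sup' hT fun s => A s - w s) := by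
  obtain ⟨s, hs, es⟩ := Finset.exists_mem_eq_sup' hT fun s => A s + v s
  obtain ⟨t, ht, et⟩ := Finset.exists_mem_eq_sup' hT fun s => A s - v s
  rw [es, et]
  have hM : ∀ s ∈ T, A s + w s ≤ T.sup' hT fun s => A s + w s :=
    fun s hs => Finset.le_sup' (fun s => A s + w s) hs
  have hN : ∀ s ∈ T, A s - w s ≤ T.sup' hT fun s => A s - w s :=
    fun s hs => Finset.le_sup' (fun s => A s - w s) hs
  have habs : ∀ s ∈ T, A s + |w s| ≤
      max (T.sup' hT fun s => A s + w s) (T.sup' hT fun s => A s - w s) := by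
    intro s hs
    rcases abs_cases (w s) with ⟨h, _⟩ | ⟨h, _⟩ <;> rw [h]
    · exact le_max_of_le_left (hM s hs)
    · exact le_max_of_le_right (hN s hs)
  apply exp_add_exp_le
  · linarith [habs s hs, hv s, le_abs_self (v s)]
  · linarith [habs t ht, hv t, neg_abs_le (v t)]
  · have h := (le_abs_self _).trans (hvw s t)
    rcases abs_cases (w s - w t) with ⟨h', _⟩ | ⟨h', _⟩ <;> rw [h'] at h
    · linarith [hM s hs, hN t ht]
    · linarith [hM t ht, hN s hs]

lemma sum_bool_cons {m : ℕ} (F : (Fin (m + 1) → Bool) → ℝ) :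
    ∑ σ, F σ = ∑ σ : Fin m → Bool,
      (F (Fin.cons (α := fun _ => Bool) true σ) + F (Fin.cons (α := fun _ => Bool) false σ)) := by
  rw [← (Fin.consEquiv fun _ : Fin (m + 1) => Bool).sum_comp, Fintype.sum_prod_type_right]
  simp [Fin.consEquiv]

/-- The contraction principle for exponential moments of suprema of Rademacher processes. -/
lemma exp_sup_contraction {α : Type*} {T : Finset α} (hT : T.Nonempty) {m : ℕ}
    (A : α → ℝ) (v w : Fin m → α → ℝ)
    (hvw : ∀ k s t, |v k s - v k t| ≤ |w k s - w k t|) (hv : ∀ k s, |v k s| ≤ |w k s|) :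
    ∑ σ : Fin m → Bool, Real.exp (T.sup' hT fun s => A s + ∑ k, sgn (σ k) * v k s) ≤
      ∑ σ : Fin m → Bool, Real.exp (T.sup' hT fun s => A s + ∑ k, sgn (σ k) * w k s) := by
  induction m generalizing A with
  | zero => simp
  | succ m ih =>
    rw [sum_bool_cons, sum_bool_cons]
    simp only [Fin.sum_univ_succ, Fin.cons_zero, Fin.cons_succ, sgn_true, sgn_false, one_mul,
      neg_one_mul]
    calc _ ≤ ∑ σ : Fin m → Bool,
          (Real.exp (T.sup' hT fun s => (A s + w 0 s) + ∑ k, sgn (σ k) * v k.succ s) +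
           Real.exp (T.sup' hT fun s => (A s - w 0 s) + ∑ k, sgn (σ k) * v k.succ s)) := by
          refine Finset.sum_le_sum fun σ _ => ?_
          have := exp_sup_contraction_step hT (fun s => A s + ∑ k, sgn (σ k) * v k.succ s)
            (v 0) (w 0) (hvw 0) (hv 0)
          refine le_of_eq_of_le ?_ (this.trans_eq ?_) <;>
            (congr 1 <;> (congr 2; ext s; ring))
      _ ≤ _ := by
          rw [Finset.sum_add_distrib, Finset.sum_add_distrib]
          have h1 := ih (fun s => A s + w 0 s) (fun k => v k.succ) (fun k => w k.succ)
            (fun k => hvw k.succ) (fun k => hv k.succ)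
          have h2 := ih (fun s => A s - w 0 s) (fun k => v k.succ) (fun k => w k.succ)
            (fun k => hvw k.succ) (fun k => hv k.succ)
          refine (add_le_add h1 h2).trans (le_of_eq ?_)
          congr 1 <;> (refine Finset.sum_congr rfl fun σ _ => ?_; congr 2; ext s; ring)

/-- The moment generating function of a Rademacher sum is subgaussian. -/
lemma sum_exp_rademacher_le {m : ℕ} (c : Fin m → ℝ) :
    ∑ σ : Fin m → Bool, Real.exp (∑ k, sgn (σ k) * c k) ≤
      2 ^ m * Real.exp (∑ k, c k ^ 2 / 2) := by
  induction m with
  | zero => simp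
  | succ m ih =>
    rw [sum_bool_cons]
    simp only [Fin.sum_univ_succ, Fin.cons_zero, Fin.cons_succ]
    have h := Real.cosh_le_exp_half_sq (c 0)
    rw [Real.cosh_eq] at h
    calc _ = (Real.exp (c 0) + Real.exp (-c 0)) *
          ∑ σ : Fin m → Bool, Real.exp (∑ k, sgn (σ k) * c k.succ) := by
          rw [Finset.mul_sum]
          refine Finset.sum_congr rfl fun σ _ => ?_
          simp [Real.exp_add, sgn]
          ring
      _ ≤ (2 * Real.exp (c 0 ^ 2 / 2)) * (2 ^ m * Real.exp (∑ k : Fin m, c k.succ ^ 2 / 2)) := by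
          gcongr
          · linarith
          · exact ih _
      _ = _ := by rw [Real.exp_add]; ring

/-- Exponential Rademacher complexity of an `ℓ¹`-ball composed with a `1`-Lipschitz function. -/
lemma sum_exp_sup_l1_le {p m : ℕ} [NeZero p] {T : Finset (Fin p → ℝ)} (hT : T.Nonempty) {B κ s : ℝ}
    (hs : 0 ≤ s)
    (hTB : ∀ μ ∈ T, l1norm μ ≤ B) (x : Fin m → Fin p → ℝ) (hx : ∀ k i, |x k i| ≤ κ)
    {φ : ℝ → ℝ} (hφ : ∀ a b, |φ a - φ b| ≤ |a - b|) (hφ0 : φ 0 = 0) :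
    ∑ σ : Fin m → Bool, Real.exp (T.sup' hT fun μ => s * ∑ k, sgn (σ k) * φ (ip μ (x k))) ≤
      2 ^ m * (2 * p * Real.exp (s ^ 2 * (B * κ) ^ 2 * m / 2)) := by
  have h1 := exp_sup_contraction hT (fun _ => 0) (fun k μ => s * φ (ip μ (x k)))
    (fun k μ => s * ip μ (x k))
    (fun k μ ν => by
      rw [← mul_sub, ← mul_sub, abs_mul, abs_mul]
      exact mul_le_mul_of_nonneg_left (hφ _ _) (abs_nonneg s))
    (fun k μ => by
      rw [abs_mul, abs_mul]
      refine mul_le_mul_of_nonneg_left ?_ (abs_nonneg s)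
      simpa [hφ0] using hφ (ip μ (x k)) 0)
  have hc : ∀ (e : ℝ), |e| ≤ 1 → ∀ i, ∑ σ : Fin m → Bool,
      Real.exp (∑ k, sgn (σ k) * (e * (s * B * x k i))) ≤
        2 ^ m * Real.exp (s ^ 2 * (B * κ) ^ 2 * m / 2) := by
    intro e he i
    refine (sum_exp_rademacher_le _).trans ?_
    gcongr
    calc ∑ k, (e * (s * B * x k i)) ^ 2 / 2 ≤ ∑ _k : Fin m, (s * B * κ) ^ 2 / 2 := by
          refine Finset.sum_le_sum fun k _ => ?_
          have h : |e * (s * B * x k i)| ≤ |s * B * κ| := by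
            rw [abs_mul, abs_mul, abs_mul (s * B)]
            calc |e| * (|s * B| * |x k i|) ≤ 1 * (|s * B| * |κ|) := by
                  have := (hx k i).trans (le_abs_self κ)
                  gcongr
              _ = _ := one_mul _
          linarith [sq_le_sq.2 h]
      _ = _ := by simp; ring
  calc _ = ∑ σ : Fin m → Bool,
        Real.exp (T.sup' hT fun μ => 0 + ∑ k, sgn (σ k) * (s * φ (ip μ (x k)))) := by
        refine Finset.sum_congr rfl fun σ _ => ?_
        congr 2; ext μ
        rw [zero_add, Finset.mul_sum]
        exact Finset.sum_congr rfl fun k _ => by ring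
    _ ≤ _ := h1
    _ ≤ ∑ σ : Fin m → Bool, ∑ i, (Real.exp (∑ k, sgn (σ k) * (1 * (s * B * x k i))) +
          Real.exp (∑ k, sgn (σ k) * (-1 * (s * B * x k i)))) := by
        refine Finset.sum_le_sum fun σ _ => ?_
        obtain ⟨μ, hμ, e⟩ := Finset.exists_mem_eq_sup' hT
          fun μ => 0 + ∑ k, sgn (σ k) * (s * ip μ (x k))
        rw [e, zero_add]
        set y : Fin p → ℝ := fun i => ∑ k, sgn (σ k) * x k i with hy
        have e1 : ∑ k, sgn (σ k) * (s * ip μ (x k)) = s * ∑ i, μ i * y i := by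
          simp only [ip, hy, Finset.mul_sum]
          rw [Finset.sum_comm]
          exact Finset.sum_congr rfl fun i _ => Finset.sum_congr rfl fun k _ => by ring
        have e2 : ∀ i (e : ℝ), ∑ k, sgn (σ k) * (e * (s * B * x k i)) = e * (s * B * y i) := by
          intro i e
          simp only [hy, Finset.mul_sum]
          exact Finset.sum_congr rfl fun k _ => by ring
        simp only [e1, e2]
        obtain ⟨i, -, hi⟩ := Finset.exists_max_image Finset.univ (fun i => |y i|)
          Finset.univ_nonempty
        have hb : s * ∑ i, μ i * y i ≤ s * B * |y i| := by
          rw [mul_assoc]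
          refine mul_le_mul_of_nonneg_left ?_ hs
          calc ∑ j, μ j * y j ≤ ∑ j, |μ j| * |y i| := by
                refine Finset.sum_le_sum fun j hj => ?_
                refine (le_abs_self _).trans ?_
                rw [abs_mul]
                exact mul_le_mul_of_nonneg_left (hi j hj) (abs_nonneg _)
            _ = l1norm μ * |y i| := by rw [l1norm, Finset.sum_mul]
            _ ≤ _ := mul_le_mul_of_nonneg_right (hTB μ hμ) (abs_nonneg _)
        refine le_trans ?_ (Finset.single_le_sum
          (f := fun i => Real.exp (1 * (s * B * y i)) + Real.exp (-1 * (s * B * y i)))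
          (fun i _ => by positivity) (Finset.mem_univ i))
        rcases abs_cases (y i) with ⟨h, _⟩ | ⟨h, _⟩ <;> rw [h] at hb
        · have := Real.exp_le_exp.2 (hb.trans_eq (one_mul (s * B * y i)).symm)
          linarith [Real.exp_pos (-1 * (s * B * y i))]
        · have := Real.exp_le_exp.2 (hb.trans_eq (by ring : _ = -1 * (s * B * y i)))
          linarith [Real.exp_pos (1 * (s * B * y i))]
    _ = ∑ i, (∑ σ : Fin m → Bool, Real.exp (∑ k, sgn (σ k) * (1 * (s * B * x k i))) +
          ∑ σ : Fin m → Bool, Real.exp (∑ k, sgn (σ k) * (-1 * (s * B * x k i)))) := by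
        rw [Finset.sum_comm]
        simp only [Finset.sum_add_distrib]
    _ ≤ ∑ _i : Fin p, (2 ^ m * Real.exp (s ^ 2 * (B * κ) ^ 2 * m / 2) +
          2 ^ m * Real.exp (s ^ 2 * (B * κ) ^ 2 * m / 2)) :=
        Finset.sum_le_sum fun i _ => add_le_add (hc 1 (by simp) i) (hc (-1) (by simp) i)
    _ = _ := by simp; ring

section Symmetrization

variable {α W : Type*} [MeasurableSpace W]

lemma integrable_exp_sup {Ω : Type*} [MeasurableSpace Ω] (P : Measure Ω) [IsFiniteMeasure P]
    {T : Finset α} (hT : T.Nonempty) {F : α → Ω → ℝ} (hF : ∀ μ, Measurable (F μ)) {C : ℝ}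
    (hC : ∀ μ ∈ T, ∀ ω, |F μ ω| ≤ C) :
    Integrable (fun ω => Real.exp (T.sup' hT fun μ => F μ ω)) P := by
  have hm : Measurable fun ω => T.sup' hT fun μ => F μ ω := by
    have := Finset.measurable_sup' hT (f := F) fun μ _ => hF μ
    convert this using 2 with ω
    rw [Finset.sup'_apply]
  refine Integrable.of_bound hm.exp.aestronglyMeasurable (Real.exp C)
    (Filter.Eventually.of_forall fun ω => ?_)
  rw [Real.norm_eq_abs, Real.abs_exp]
  exact Real.exp_le_exp.2 (Finset.sup'_le hT _ fun μ hμ => (le_abs_self _).trans (hC μ hμ ω))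

/-- Jensen's inequality for the exponential. -/
lemma exp_integral_le {Ω : Type*} [MeasurableSpace Ω] (P : Measure Ω) [IsProbabilityMeasure P]
    {f : Ω → ℝ} (hf : Integrable f P) (hef : Integrable (fun ω => Real.exp (f ω)) P) :
    Real.exp (∫ ω, f ω ∂P) ≤ ∫ ω, Real.exp (f ω) ∂P :=
  convexOn_exp.map_integral_le Real.continuous_exp.continuousOn isClosed_univ
    (Filter.Eventually.of_forall fun _ => Set.mem_univ _) hf hef

lemma measurePreserving_eval_pair (D : Measure W) [IsProbabilityMeasure D] {n : ℕ} {i j : Fin n}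
    (hij : i ≠ j) :
    MeasurePreserving (fun S : Fin n → W => (S i, S j)) (Measure.pi fun _ => D) (D.prod D) := by
  refine ⟨by fun_prop, ?_⟩
  have h := (ProbabilityTheory.iIndepFun_pi (μ := fun _ : Fin n => D)
    (X := fun _ w => w) (fun _ => aemeasurable_id)).indepFun hij
  have h' := (ProbabilityTheory.indepFun_iff_map_prod_eq_prod_map_map
    (measurable_pi_apply i).aemeasurable (measurable_pi_apply j).aemeasurable).1 h
  rw [h']
  congr 1
  · exact (measurePreserving_eval (fun _ : Fin n => D) i).map_eq
  · exact (measurePreserving_eval (fun _ : Fin n => D) j).map_eq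

/-- Exchange of the coordinates selected by `τ` between a sample and a ghost sample. -/
def swapOn {n : ℕ} (τ : Fin n → Bool) (q : (Fin n → W) × (Fin n → W)) :
    (Fin n → W) × (Fin n → W) :=
  (fun i => if τ i then q.1 i else q.2 i, fun i => if τ i then q.2 i else q.1 i)

lemma measurePreserving_swapOn (D : Measure W) [IsProbabilityMeasure D] {n : ℕ}
    (τ : Fin n → Bool) :
    MeasurePreserving (swapOn τ) ((Measure.pi fun _ : Fin n => D).prod (Measure.pi fun _ => D))
      ((Measure.pi fun _ : Fin n => D).prod (Measure.pi fun _ => D)) := by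
  have h1 := measurePreserving_arrowProdEquivProdArrow W W (Fin n) (fun _ => D) (fun _ => D)
  have h2 := measurePreserving_pi (fun _ : Fin n => D.prod D) (fun _ : Fin n => D.prod D)
    (f := fun i => if τ i then id else Prod.swap) (fun i => by
      split_ifs
      · exact MeasurePreserving.id _
      · exact Measure.measurePreserving_swap)
  convert h1.comp (h2.comp h1.symm) using 1
  ext q i <;> by_cases h : τ i <;>
    simp [swapOn, h, MeasurableEquiv.arrowProdEquivProdArrow, Equiv.arrowProdEquivProdArrow]

/-- Exponential symmetrization for a block of independent pairs. -/
lemma integral_exp_sup_pairs_le (D : Measure W) [IsProbabilityMeasure D] {n m : ℕ}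
    {a b : Fin m → Fin n} (hab : Function.Injective (Sum.elim a b)) {T : Finset α}
    (hT : T.Nonempty) {g : α → W → W → ℝ} (hg : ∀ μ, Measurable fun w : W × W => g μ w.1 w.2)
    {M : ℝ} (hM : ∀ μ ∈ T, ∀ w w', |g μ w w'| ≤ M) {t Q : ℝ}
    (hQ : ∀ x : Fin m → W × W, ∑ σ : Fin m → Bool,
      Real.exp (T.sup' hT fun μ => 2 * t * ∑ k, sgn (σ k) * g μ (x k).1 (x k).2) ≤ 2 ^ m * Q) :
    ∫ S, Real.exp (T.sup' hT fun μ =>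
      t * ∑ k, (∫ w, g μ w.1 w.2 ∂(D.prod D) - g μ (S (a k)) (S (b k))))
        ∂(Measure.pi fun _ : Fin n => D) ≤ Q := by
  set P := Measure.pi fun _ : Fin n => D with hP
  have hne : ∀ k, a k ≠ b k := fun k h => by
    have := @hab (Sum.inl k) (Sum.inr k) (by simpa using h)
    simp at this
  have hgS : ∀ μ k, Measurable fun S : Fin n → W => g μ (S (a k)) (S (b k)) := fun μ k =>
    (hg μ).comp (measurePreserving_eval_pair D (hne k)).measurable
  have hmean : ∀ μ k, ∫ S, g μ (S (a k)) (S (b k)) ∂P = ∫ w, g μ w.1 w.2 ∂(D.prod D) := by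
    intro μ k
    have h := measurePreserving_eval_pair D (hne k)
    rw [← h.map_eq, integral_map h.measurable.aemeasurable (hg μ).aestronglyMeasurable]
  have hint : ∀ μ ∈ T, ∀ k, Integrable (fun S : Fin n → W => g μ (S (a k)) (S (b k))) P :=
    fun μ hμ k => Integrable.of_bound (hgS μ k).aestronglyMeasurable M
      (Filter.Eventually.of_forall fun S => hM μ hμ _ _)
  set G : (Fin m → Bool) → α → (Fin n → W) × (Fin n → W) → ℝ := fun σ μ q =>
    t * ∑ k, sgn (σ k) * (g μ (q.2 (a k)) (q.2 (b k)) - g μ (q.1 (a k)) (q.1 (b k))) with hG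
  have hGm : ∀ σ μ, Measurable (G σ μ) := fun σ μ =>
    (Finset.measurable_sum _ fun k _ => (((hgS μ k).comp measurable_snd).sub
      ((hgS μ k).comp measurable_fst)).const_mul _).const_mul _
  have hsgn : ∀ c : Bool, |sgn c| = 1 := fun c => by cases c <;> simp [sgn]
  have hGb : ∀ σ, ∀ μ ∈ T, ∀ q, |G σ μ q| ≤ |t| * (m * (2 * M)) := by
    intro σ μ hμ q
    simp only [hG, abs_mul]
    refine mul_le_mul_of_nonneg_left ?_ (abs_nonneg t)
    refine (Finset.abs_sum_le_sum_abs _ _).trans ?_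
    calc _ ≤ ∑ _k : Fin m, 2 * M := Finset.sum_le_sum fun k _ => by
          rw [abs_mul, hsgn, one_mul]
          linarith [abs_sub (g μ (q.2 (a k)) (q.2 (b k))) (g μ (q.1 (a k)) (q.1 (b k))),
            hM μ hμ (q.2 (a k)) (q.2 (b k)), hM μ hμ (q.1 (a k)) (q.1 (b k))]
      _ = _ := by simp
  have hGi : ∀ σ, Integrable (fun q => Real.exp (T.sup' hT fun μ => G σ μ q)) (P.prod P) :=
    fun σ => integrable_exp_sup _ hT (hGm σ) (hGb σ)
  have hGi' : ∀ σ S, Integrable (fun S' => Real.exp (T.sup' hT fun μ => G σ μ (S, S'))) P :=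
    fun σ S => integrable_exp_sup P hT (fun μ => (hGm σ μ).comp measurable_prodMk_left)
      fun μ hμ S' => hGb σ μ hμ (S, S')
  let σ₁ : Fin m → Bool := fun _ => true
  have ghost : ∀ S, Real.exp (T.sup' hT fun μ =>
      t * ∑ k, (∫ w, g μ w.1 w.2 ∂(D.prod D) - g μ (S (a k)) (S (b k)))) ≤
      ∫ S', Real.exp (T.sup' hT fun μ => G σ₁ μ (S, S')) ∂P := by
    intro S
    obtain ⟨μ, hμ, e⟩ := Finset.exists_mem_eq_sup' hT fun μ =>
      t * ∑ k, (∫ w, g μ w.1 w.2 ∂(D.prod D) - g μ (S (a k)) (S (b k)))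
    rw [e]
    have hGμ : ∫ S', G σ₁ μ (S, S') ∂P =
        t * ∑ k, (∫ w, g μ w.1 w.2 ∂(D.prod D) - g μ (S (a k)) (S (b k))) := by
      simp only [hG, σ₁, sgn_true, one_mul]
      rw [integral_const_mul, integral_finsetSum]
      · congr 1
        refine Finset.sum_congr rfl fun k _ => ?_
        rw [integral_sub (hint μ hμ k) (integrable_const _), hmean]
        simp
      · exact fun k _ => (hint μ hμ k).sub (integrable_const _)
    have hmeas : Measurable fun S' => G σ₁ μ (S, S') := (hGm σ₁ μ).comp measurable_prodMk_left
    have hi : Integrable (fun S' => G σ₁ μ (S, S')) P :=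
      Integrable.of_bound hmeas.aestronglyMeasurable _
        (Filter.Eventually.of_forall fun S' => hGb σ₁ μ hμ (S, S'))
    have hi' : Integrable (fun S' => Real.exp (G σ₁ μ (S, S'))) P := by
      refine Integrable.of_bound hmeas.exp.aestronglyMeasurable
        (Real.exp (|t| * (m * (2 * M)))) (Filter.Eventually.of_forall fun S' => ?_)
      rw [Real.norm_eq_abs, Real.abs_exp]
      exact Real.exp_le_exp.2 ((le_abs_self _).trans (hGb σ₁ μ hμ (S, S')))
    rw [← hGμ]
    refine (exp_integral_le P hi hi').trans (integral_mono hi' (hGi' σ₁ S) fun S' => ?_)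
    exact Real.exp_le_exp.2 (Finset.le_sup' (fun μ => G σ₁ μ (S, S')) hμ)
  have swap : ∀ σ, ∫ q, Real.exp (T.sup' hT fun μ => G σ₁ μ q) ∂(P.prod P) =
      ∫ q, Real.exp (T.sup' hT fun μ => G σ μ q) ∂(P.prod P) := by
    intro σ
    set τ : Fin n → Bool :=
      Function.extend (Sum.elim a b) (Sum.elim σ σ) (fun _ => false) with hτ
    have hτa : ∀ k, τ (a k) = σ k := fun k =>
      hab.extend_apply (Sum.elim σ σ) (fun _ => false) (Sum.inl k)
    have hτb : ∀ k, τ (b k) = σ k := fun k =>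
      hab.extend_apply (Sum.elim σ σ) (fun _ => false) (Sum.inr k)
    have h := measurePreserving_swapOn D τ
    rw [← h.map_eq, integral_map h.measurable.aemeasurable, h.map_eq]
    · refine integral_congr_ae (Filter.Eventually.of_forall fun q => ?_)
      have : ∀ μ, G σ₁ μ (swapOn τ q) = G σ μ q := by
        intro μ
        simp only [hG, swapOn, hτa, hτb]
        congr 1
        refine Finset.sum_congr rfl fun k _ => ?_
        cases σ k <;> simp [σ₁, sgn]
      simp only [this]
    · rw [h.map_eq]
      exact (hGi σ₁).aestronglyMeasurable
  have pointwise : ∀ q, ∑ σ : Fin m → Bool, Real.exp (T.sup' hT fun μ => G σ μ q) ≤ 2 ^ m * Q := by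
    intro q
    set R : (Fin m → Bool) → (Fin n → W) → ℝ := fun σ S => Real.exp (T.sup' hT fun μ =>
      2 * t * ∑ k, sgn (σ k) * g μ (S (a k)) (S (b k)))
    have hRQ : ∀ S, ∑ σ, R σ S ≤ 2 ^ m * Q := fun S => hQ fun k => (S (a k), S (b k))
    have hnot : ∑ σ : Fin m → Bool, R (fun k => !σ k) q.1 = ∑ σ, R σ q.1 :=
      (Equiv.piCongrRight fun _ : Fin m => Equiv.boolNot).sum_comp fun σ => R σ q.1
    calc _ ≤ ∑ σ : Fin m → Bool, (R σ q.2 / 2 + R (fun k => !σ k) q.1 / 2) := by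
          refine Finset.sum_le_sum fun σ _ => ?_
          obtain ⟨μ, hμ, e⟩ := Finset.exists_mem_eq_sup' hT fun μ => G σ μ q
          rw [e]
          set x := t * ∑ k, sgn (σ k) * g μ (q.2 (a k)) (q.2 (b k)) with hx
          set y := t * ∑ k, sgn (!σ k) * g μ (q.1 (a k)) (q.1 (b k)) with hy
          have exy : G σ μ q = x + y := by
            simp only [hG, hx, hy, ← mul_add, ← Finset.sum_add_distrib]
            congr 1
            refine Finset.sum_congr rfl fun k _ => ?_
            cases σ k <;> simp [sgn] <;> ring
          have h1 : Real.exp (2 * x) ≤ R σ q.2 := Real.exp_le_exp.2 (by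
            have := Finset.le_sup' (fun μ =>
              2 * t * ∑ k, sgn (σ k) * g μ (q.2 (a k)) (q.2 (b k))) hμ
            rw [hx, ← mul_assoc]; exact this)
          have h2 : Real.exp (2 * y) ≤ R (fun k => !σ k) q.1 := Real.exp_le_exp.2 (by
            have := Finset.le_sup' (fun μ =>
              2 * t * ∑ k, sgn (!σ k) * g μ (q.1 (a k)) (q.1 (b k))) hμ
            rw [hy, ← mul_assoc]; exact this)
          rw [exy, Real.exp_add]
          rw [two_mul, Real.exp_add] at h1 h2
          nlinarith [sq_nonneg (Real.exp x - Real.exp y)]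
      _ ≤ _ := by
          rw [Finset.sum_add_distrib, ← Finset.sum_div, ← Finset.sum_div, hnot]
          linarith [hRQ q.1, hRQ q.2]
  have hprod : ∫ S, ∫ S', Real.exp (T.sup' hT fun μ => G σ₁ μ (S, S')) ∂P ∂P =
      ∫ q, Real.exp (T.sup' hT fun μ => G σ₁ μ q) ∂(P.prod P) :=
    (integral_prod _ (hGi σ₁)).symm
  have havg : 2 ^ m * ∫ q, Real.exp (T.sup' hT fun μ => G σ₁ μ q) ∂(P.prod P) ≤ 2 ^ m * Q := by
    calc _ = ∑ σ : Fin m → Bool, ∫ q, Real.exp (T.sup' hT fun μ => G σ μ q) ∂(P.prod P) := by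
          rw [Finset.sum_congr rfl fun σ _ => (swap σ).symm]
          simp
      _ = ∫ q, ∑ σ : Fin m → Bool, Real.exp (T.sup' hT fun μ => G σ μ q) ∂(P.prod P) :=
          (integral_finsetSum _ fun σ _ => hGi σ).symm
      _ ≤ ∫ _q, 2 ^ m * Q ∂(P.prod P) :=
          integral_mono (integrable_finsetSum _ fun σ _ => hGi σ) (integrable_const _) pointwise
      _ = _ := by simp
  refine le_trans ?_ (le_of_mul_le_mul_left havg (by positivity))
  rw [← hprod]
  exact integral_mono_of_nonneg (Filter.Eventually.of_forall fun S => (Real.exp_pos _).le)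
    (hGi σ₁).integral_prod_left (Filter.Eventually.of_forall ghost)

end Symmetrization

section UStatistic

lemma sum_perm_pair {n : ℕ} (G : Fin n → Fin n → ℝ) {a b : Fin n} (hab : a ≠ b) :
    ((n : ℝ) * (n - 1)) * ∑ π : Equiv.Perm (Fin n), G (π a) (π b) =
      (n.factorial : ℝ) * ∑ i, ∑ j, if i ≠ j then G i j else 0 := by
  set c := ∑ π : Equiv.Perm (Fin n), G (π a) (π b) with hc
  have const : ∀ i j : Fin n, i ≠ j → ∑ π : Equiv.Perm (Fin n), G (π i) (π j) = c := by
    intro i j hij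
    set τ : Equiv.Perm (Fin n) := Equiv.swap (Equiv.swap a i b) j * Equiv.swap a i with hτ
    have hb : Equiv.swap a i b ≠ i := fun h => hab.symm
      ((Equiv.swap a i).injective (h.trans (Equiv.swap_apply_left a i).symm))
    have h1 : τ a = i := by
      simp only [hτ, Equiv.Perm.mul_apply, Equiv.swap_apply_left]
      exact Equiv.swap_apply_of_ne_of_ne hb.symm hij
    have h2 : τ b = j := by simp [hτ]
    rw [hc, ← Equiv.sum_comp (Equiv.mulRight τ) fun π : Equiv.Perm (Fin n) => G (π a) (π b)]
    simp [h1, h2]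
  have lhs : ∑ i, ∑ j, (if i ≠ j then ∑ π : Equiv.Perm (Fin n), G (π i) (π j) else 0) =
      (n : ℝ) * (n - 1) * c := by
    have : ∀ i j : Fin n, (if i ≠ j then ∑ π : Equiv.Perm (Fin n), G (π i) (π j) else 0) =
        c - if i = j then c else 0 := by
      intro i j
      by_cases h : i = j
      · simp [h]
      · simp [h, const i j h]
    simp only [this, Finset.sum_sub_distrib]
    simp
    ring
  rw [← lhs]
  calc _ = ∑ π : Equiv.Perm (Fin n), ∑ i, ∑ j, if i ≠ j then G (π i) (π j) else 0 := by
        symm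
        rw [Finset.sum_comm]
        refine Finset.sum_congr rfl fun i _ => ?_
        rw [Finset.sum_comm]
        refine Finset.sum_congr rfl fun j _ => ?_
        split_ifs <;> simp
    _ = ∑ _π : Equiv.Perm (Fin n), ∑ i, ∑ j, if i ≠ j then G i j else 0 := by
        refine Finset.sum_congr rfl fun π _ => ?_
        rw [← Equiv.sum_comp π fun i => ∑ j, if i ≠ j then G i j else 0]
        refine Finset.sum_congr rfl fun i _ => ?_
        rw [← Equiv.sum_comp π fun j => if π i ≠ j then G (π i) j else 0]
        simp
    _ = _ := by simp [Fintype.card_perm]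

lemma sum_ne_eq_two_mul_sum_lt {n : ℕ} (G : Fin n → Fin n → ℝ) :
    ∑ i, ∑ j, (if i ≠ j then G (min i j) (max i j) else 0) =
      2 * ∑ i, ∑ j, if i < j then G i j else 0 := by
  have h : ∀ i j : Fin n, (if i ≠ j then G (min i j) (max i j) else 0) =
      (if i < j then G i j else 0) + if j < i then G j i else 0 := by
    intro i j
    rcases lt_trichotomy i j with h | h | h
    · simp [h, h.ne, h.le, not_lt_of_gt h]
    · simp [h]
    · simp [h, h.ne', h.le, not_lt_of_gt h]
  simp only [h, Finset.sum_add_distrib]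
  rw [Finset.sum_comm (f := fun i j : Fin n => if j < i then G j i else 0)]
  ring

variable {α W : Type*}

/-- The U-statistic of order two with kernel `g`, averaged over ordered pairs of indices. -/
def ustat {n : ℕ} (g : W → W → ℝ) (S : Fin n → W) : ℝ :=
  (2 / ((n : ℝ) * ((n : ℝ) - 1))) * ∑ i : Fin n, ∑ j : Fin n, if i < j then g (S i) (S j) else 0

lemma ustat_const {n : ℕ} (hn : 2 ≤ n) (c : ℝ) (S : Fin n → W) :
    ustat (fun _ _ => c) S = c := by
  have hn' : (2 : ℝ) ≤ n := by exact_mod_cast hn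
  have h := sum_ne_eq_two_mul_sum_lt (fun _ _ : Fin n => c)
  have h' : ∑ i : Fin n, ∑ j : Fin n, (if i ≠ j then c else 0) = n * (n - 1) * c := by
    have : ∀ i j : Fin n, (if i ≠ j then c else 0) = c - if i = j then c else 0 := by
      intro i j
      by_cases h : i = j <;> simp [h]
    simp only [this, Finset.sum_sub_distrib]
    simp
    ring
  rw [h'] at h
  have hn0 : (n : ℝ) ≠ 0 := by linarith
  have hn1 : (n : ℝ) - 1 ≠ 0 := by linarith
  rw [ustat, div_mul_eq_mul_div, ← h]
  field_simp

lemma ustat_add {n : ℕ} (g g' : W → W → ℝ) (S : Fin n → W) :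
    ustat (fun w w' => g w w' + g' w w') S = ustat g S + ustat g' S := by
  simp only [ustat, ← mul_add, ← Finset.sum_add_distrib]
  congr 1
  exact Finset.sum_congr rfl fun i _ => Finset.sum_congr rfl fun j _ => by split_ifs <;> simp

lemma ustat_neg {n : ℕ} (g : W → W → ℝ) (S : Fin n → W) :
    ustat (fun w w' => -g w w') S = -ustat g S := by
  simp only [ustat, ← mul_neg, ← Finset.sum_neg_distrib]
  congr 1
  exact Finset.sum_congr rfl fun i _ => Finset.sum_congr rfl fun j _ => by split_ifs <;> simp

lemma ustat_mono {n : ℕ} (hn : 2 ≤ n) {g g' : W → W → ℝ} (h : ∀ w w', g w w' ≤ g' w w')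
    (S : Fin n → W) : ustat g S ≤ ustat g' S := by
  have hn' : (2 : ℝ) ≤ n := by exact_mod_cast hn
  refine mul_le_mul_of_nonneg_left ?_
    (div_nonneg zero_le_two (mul_nonneg (by linarith) (by linarith)))
  exact Finset.sum_le_sum fun i _ => Finset.sum_le_sum fun j _ => by
    split_ifs
    · exact h _ _
    · exact le_rfl

/-- A U-statistic is an average over permutations of means over disjoint pairs. -/
lemma ustat_eq_perm_average {m : ℕ} (hm : 0 < m) (g : W → W → ℝ) (S : Fin (m + m) → W) :
    ((m + m).factorial : ℝ) * (m * ustat g S) =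
      ∑ π : Equiv.Perm (Fin (m + m)), ∑ k : Fin m,
        g (S (min (π (Fin.castAdd m k)) (π (Fin.natAdd m k))))
          (S (max (π (Fin.castAdd m k)) (π (Fin.natAdd m k)))) := by
  have hm' : (1 : ℝ) ≤ m := by exact_mod_cast hm
  have hpos : (0 : ℝ) < (m + m : ℕ) * ((m + m : ℕ) - 1) := by
    push_cast; exact mul_pos (by linarith) (by linarith)
  refine mul_left_cancel₀ hpos.ne' ?_
  have hk : ∀ k : Fin m, Fin.castAdd m k ≠ Fin.natAdd m k := by
    intro k h
    have := congrArg Fin.val h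
    simp at this
    omega
  rw [Finset.sum_comm, Finset.mul_sum]
  have h1 : ∀ k : Fin m, ((m + m : ℕ) : ℝ) * ((m + m : ℕ) - 1) *
      ∑ π : Equiv.Perm (Fin (m + m)), g (S (min (π (Fin.castAdd m k)) (π (Fin.natAdd m k))))
        (S (max (π (Fin.castAdd m k)) (π (Fin.natAdd m k)))) =
      ((m + m).factorial : ℝ) * (2 * ∑ i, ∑ j, if i < j then g (S i) (S j) else 0) := by
    intro k
    rw [← sum_ne_eq_two_mul_sum_lt fun i j => g (S i) (S j)]
    exact sum_perm_pair (fun i j => g (S (min i j)) (S (max i j))) (hk k)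
  rw [Finset.sum_congr rfl fun k _ => h1 k]
  simp only [ustat, Finset.sum_const, Finset.card_univ, Fintype.card_fin, nsmul_eq_mul]
  have h0 : ((m + m : ℕ) : ℝ) ≠ 0 := (pos_of_mul_pos_left hpos (by push_cast; linarith)).ne'
  have h2 : ((m + m : ℕ) : ℝ) - 1 ≠ 0 := by push_cast; linarith
  field_simp

lemma injective_perm_pairs {m : ℕ} (π : Equiv.Perm (Fin (m + m))) :
    Function.Injective (Sum.elim
      (fun k : Fin m => min (π (Fin.castAdd m k)) (π (Fin.natAdd m k)))
      (fun k : Fin m => max (π (Fin.castAdd m k)) (π (Fin.natAdd m k)))) := by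
  have key : ∀ k l : Fin m, ∀ x y, (x = Fin.castAdd m k ∨ x = Fin.natAdd m k) →
      (y = Fin.castAdd m l ∨ y = Fin.natAdd m l) → π x = π y → k = l := by
    intro k l x y hx hy h
    have hxy := congrArg Fin.val (π.injective h)
    ext
    rcases hx with rfl | rfl <;> rcases hy with rfl | rfl <;> simp at hxy <;> omega
  have hmin : ∀ k : Fin m, ∃ x, (x = Fin.castAdd m k ∨ x = Fin.natAdd m k) ∧
      min (π (Fin.castAdd m k)) (π (Fin.natAdd m k)) = π x := by
    intro k
    rcases min_choice (π (Fin.castAdd m k)) (π (Fin.natAdd m k)) with h | h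
    exacts [⟨_, Or.inl rfl, h⟩, ⟨_, Or.inr rfl, h⟩]
  have hmax : ∀ k : Fin m, ∃ x, (x = Fin.castAdd m k ∨ x = Fin.natAdd m k) ∧
      max (π (Fin.castAdd m k)) (π (Fin.natAdd m k)) = π x := by
    intro k
    rcases max_choice (π (Fin.castAdd m k)) (π (Fin.natAdd m k)) with h | h
    exacts [⟨_, Or.inl rfl, h⟩, ⟨_, Or.inr rfl, h⟩]
  have hne : ∀ k : Fin m, min (π (Fin.castAdd m k)) (π (Fin.natAdd m k)) ≠
      max (π (Fin.castAdd m k)) (π (Fin.natAdd m k)) := by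
    intro k h
    have := congrArg Fin.val (π.injective (inf_eq_sup.1 h))
    simp at this
    omega
  rintro (k | k) (l | l) h <;> simp only [Sum.elim_inl, Sum.elim_inr] at h
  · obtain ⟨x, hx, ex⟩ := hmin k
    obtain ⟨y, hy, ey⟩ := hmin l
    rw [key k l x y hx hy (by rw [← ex, ← ey, h])]
  · obtain ⟨x, hx, ex⟩ := hmin k
    obtain ⟨y, hy, ey⟩ := hmax l
    obtain rfl := key k l x y hx hy (by rw [← ex, ← ey, h])
    exact absurd h (hne k)
  · obtain ⟨x, hx, ex⟩ := hmax k
    obtain ⟨y, hy, ey⟩ := hmin l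
    obtain rfl := key k l x y hx hy (by rw [← ex, ← ey, h])
    exact absurd h.symm (hne k)
  · obtain ⟨x, hx, ex⟩ := hmax k
    obtain ⟨y, hy, ey⟩ := hmax l
    rw [key k l x y hx hy (by rw [← ex, ← ey, h])]

variable [MeasurableSpace W]

lemma measurable_ustat {n : ℕ} {g : W → W → ℝ} (hg : Measurable fun w : W × W => g w.1 w.2) :
    Measurable (ustat (n := n) g) := by
  refine (Finset.measurable_sum _ fun i _ => Finset.measurable_sum _ fun j _ => ?_).const_mul _
  split_ifs
  · exact hg.comp (f := fun S : Fin n → W => (S i, S j))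
      ((measurable_pi_apply i).prodMk (measurable_pi_apply j))
  · exact measurable_const

/-- Exponential moment of the supremum of a U-process, from a Rademacher exponential moment. -/
lemma integral_exp_sup_ustat_le (D : Measure W) [IsProbabilityMeasure D] {m : ℕ} (hm : 0 < m)
    {T : Finset α} (hT : T.Nonempty) {g : α → W → W → ℝ}
    (hg : ∀ μ, Measurable fun w : W × W => g μ w.1 w.2)
    {M : ℝ} (hM : ∀ μ ∈ T, ∀ w w', |g μ w w'| ≤ M) {t Q : ℝ}
    (hQ : ∀ x : Fin m → W × W, ∑ σ : Fin m → Bool,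
      Real.exp (T.sup' hT fun μ => 2 * t * ∑ k, sgn (σ k) * g μ (x k).1 (x k).2) ≤ 2 ^ m * Q) :
    ∫ S, Real.exp (T.sup' hT fun μ =>
      t * (m * (∫ w, g μ w.1 w.2 ∂(D.prod D) - ustat (g μ) S)))
        ∂(Measure.pi fun _ : Fin (m + m) => D) ≤ Q := by
  set P := Measure.pi fun _ : Fin (m + m) => D with hP
  set H : Equiv.Perm (Fin (m + m)) → α → (Fin (m + m) → W) → ℝ := fun π μ S =>
    t * ∑ k : Fin m, (∫ w, g μ w.1 w.2 ∂(D.prod D) -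
      g μ (S (min (π (Fin.castAdd m k)) (π (Fin.natAdd m k))))
          (S (max (π (Fin.castAdd m k)) (π (Fin.natAdd m k))))) with hH
  have hHm : ∀ π μ, Measurable (H π μ) := fun π μ =>
    (Finset.measurable_sum _ fun k _ => measurable_const.sub
      ((hg μ).comp (f := fun S : Fin (m + m) → W =>
        (S (min (π (Fin.castAdd m k)) (π (Fin.natAdd m k))),
          S (max (π (Fin.castAdd m k)) (π (Fin.natAdd m k)))))
        ((measurable_pi_apply _).prodMk (measurable_pi_apply _)))).const_mul _
  have hmeanM : ∀ μ ∈ T, |∫ w, g μ w.1 w.2 ∂(D.prod D)| ≤ M := by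
    intro μ hμ
    have := norm_integral_le_of_norm_le_const (μ := D.prod D) (f := fun w => g μ w.1 w.2)
      (Filter.Eventually.of_forall fun w => hM μ hμ w.1 w.2)
    simpa using this
  have hHb : ∀ π, ∀ μ ∈ T, ∀ S, |H π μ S| ≤ |t| * (m * (2 * M)) := by
    intro π μ hμ S
    simp only [hH, abs_mul]
    refine mul_le_mul_of_nonneg_left ?_ (abs_nonneg t)
    refine (Finset.abs_sum_le_sum_abs _ _).trans ?_
    calc _ ≤ ∑ _k : Fin m, 2 * M := Finset.sum_le_sum fun k _ => by
          refine (abs_sub _ _).trans ?_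
          linarith [hmeanM μ hμ, hM μ hμ (S (min (π (Fin.castAdd m k)) (π (Fin.natAdd m k))))
            (S (max (π (Fin.castAdd m k)) (π (Fin.natAdd m k))))]
      _ = _ := by simp
  have hHi : ∀ π, Integrable (fun S => Real.exp (T.sup' hT fun μ => H π μ S)) P :=
    fun π => integrable_exp_sup P hT (hHm π) (hHb π)
  have hHQ : ∀ π, ∫ S, Real.exp (T.sup' hT fun μ => H π μ S) ∂P ≤ Q := fun π =>
    integral_exp_sup_pairs_le D (injective_perm_pairs π) hT hg hM hQ
  have hfac : (0 : ℝ) < (m + m).factorial := by exact_mod_cast Nat.factorial_pos _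
  have pointwise : ∀ S, Real.exp (T.sup' hT fun μ =>
      t * (m * (∫ w, g μ w.1 w.2 ∂(D.prod D) - ustat (g μ) S))) ≤
      ∑ π, ((m + m).factorial : ℝ)⁻¹ * Real.exp (T.sup' hT fun μ => H π μ S) := by
    intro S
    obtain ⟨μ, hμ, e⟩ := Finset.exists_mem_eq_sup' hT fun μ =>
      t * (m * (∫ w, g μ w.1 w.2 ∂(D.prod D) - ustat (g μ) S))
    have havg : t * (m * (∫ w, g μ w.1 w.2 ∂(D.prod D) - ustat (g μ) S)) =
        ∑ π : Equiv.Perm (Fin (m + m)), ((m + m).factorial : ℝ)⁻¹ • H π μ S := by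
      have h := ustat_eq_perm_average hm (g μ) S
      simp only [hH, smul_eq_mul, Finset.sum_sub_distrib]
      rw [← Finset.mul_sum, ← Finset.mul_sum, Finset.sum_sub_distrib, ← h]
      simp only [Finset.sum_const, Finset.card_univ, Fintype.card_perm, Fintype.card_fin,
        nsmul_eq_mul]
      field_simp
    rw [e, havg]
    refine (convexOn_exp.map_sum_le (fun _ _ => by positivity) ?_
      fun _ _ => Set.mem_univ _).trans ?_
    · simp only [Finset.sum_const, Finset.card_univ, Fintype.card_perm, Fintype.card_fin,
        nsmul_eq_mul]
      field_simp
    · refine Finset.sum_le_sum fun π _ => ?_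
      rw [smul_eq_mul]
      refine mul_le_mul_of_nonneg_left ?_ (by positivity)
      exact Real.exp_le_exp.2 (Finset.le_sup' (fun μ => H π μ S) hμ)
  calc _ ≤ ∫ S, ∑ π, ((m + m).factorial : ℝ)⁻¹ * Real.exp (T.sup' hT fun μ => H π μ S) ∂P :=
        integral_mono_of_nonneg (Filter.Eventually.of_forall fun S => (Real.exp_pos _).le)
          (integrable_finsetSum _ fun π _ => (hHi π).const_mul _)
          (Filter.Eventually.of_forall pointwise)
    _ = ∑ π, ((m + m).factorial : ℝ)⁻¹ * ∫ S, Real.exp (T.sup' hT fun μ => H π μ S) ∂P := by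
        rw [integral_finsetSum _ fun π _ => (hHi π).const_mul _]
        simp only [integral_const_mul]
    _ ≤ ∑ _π : Equiv.Perm (Fin (m + m)), ((m + m).factorial : ℝ)⁻¹ * Q :=
        Finset.sum_le_sum fun π _ => mul_le_mul_of_nonneg_left (hHQ π) (by positivity)
    _ = Q := by
        simp only [Finset.sum_const, Finset.card_univ, Fintype.card_perm, Fintype.card_fin,
          nsmul_eq_mul]
        field_simp

lemma abs_ip_le {p : ℕ} (μ : Fin p → ℝ) {v : Fin p → ℝ} {κ : ℝ} (hv : ∀ i, |v i| ≤ κ) :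
    |ip μ v| ≤ l1norm μ * κ := by
  rw [l1norm, Finset.sum_mul]
  refine (Finset.abs_sum_le_sum_abs _ _).trans (Finset.sum_le_sum fun i _ => ?_)
  rw [abs_mul]
  exact mul_le_mul_of_nonneg_left (hv i) (abs_nonneg _)

/-- One-sided uniform deviation bound for U-statistics whose kernels are Lipschitz functions of
linear functionals from an `ℓ¹`-ball. -/
lemma measure_ustat_deviation_le (D : Measure W) [IsProbabilityMeasure D] {m p : ℕ} [NeZero p]
    (hm : 0 < m) {T : Finset (Fin p → ℝ)} (hT : T.Nonempty) {B κ c : ℝ} (hB : 0 < B) (hκ : 0 < κ)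
    (hc : 0 < c) (hTB : ∀ μ ∈ T, l1norm μ ≤ B) {f : W → W → Fin p → ℝ}
    (hf : ∀ i, Measurable fun w : W × W => f w.1 w.2 i) (hfκ : ∀ w w' i, |f w w' i| ≤ κ)
    {φ : ℝ → ℝ} (hφ : ∀ a b, |φ a - φ b| ≤ |a - b|) (hφ0 : φ 0 = 0) :
    (Measure.pi fun _ : Fin (m + m) => D).real {S | ∃ μ ∈ T,
      c ≤ ∫ w, φ (ip μ (f w.1 w.2)) ∂(D.prod D) - ustat (fun w w' => φ (ip μ (f w w'))) S} ≤
      2 * p * Real.exp (-(c ^ 2 * m / (8 * (B * κ) ^ 2))) := by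
  set P := Measure.pi fun _ : Fin (m + m) => D with hP
  set L := B * κ
  have hLpos : 0 < L := mul_pos hB hκ
  have hm' : (0 : ℝ) < m := by exact_mod_cast hm
  have hφm : Measurable φ := by
    have : LipschitzWith 1 φ := LipschitzWith.of_dist_le_mul fun a b => by
      simpa [Real.dist_eq] using hφ a b
    exact this.continuous.measurable
  have hg : ∀ μ : Fin p → ℝ, Measurable fun w : W × W => φ (ip μ (f w.1 w.2)) := fun μ =>
    hφm.comp (Finset.measurable_sum _ fun i _ => (hf i).const_mul _)
  have hM : ∀ μ ∈ T, ∀ w w', |φ (ip μ (f w w'))| ≤ L := by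
    intro μ hμ w w'
    have h1 := hφ (ip μ (f w w')) 0
    rw [hφ0, sub_zero, sub_zero] at h1
    exact h1.trans ((abs_ip_le μ (hfκ w w')).trans
      (mul_le_mul_of_nonneg_right (hTB μ hμ) hκ.le))
  set t := c / (4 * L ^ 2) with ht
  have htpos : 0 < t := by positivity
  have hI := integral_exp_sup_ustat_le D hm hT (g := fun μ w w' => φ (ip μ (f w w'))) hg hM
    (t := t) (fun x => sum_exp_sup_l1_le hT (s := 2 * t) (by positivity) hTB
      (fun k => f (x k).1 (x k).2) (fun k i => hfκ _ _ i) hφ hφ0)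
  set F : (Fin (m + m) → W) → ℝ := fun S => Real.exp (T.sup' hT fun μ =>
      t * (m * (∫ w, φ (ip μ (f w.1 w.2)) ∂(D.prod D) -
        ustat (fun w w' => φ (ip μ (f w w'))) S))) with hF
  have hmeanM : ∀ μ ∈ T, |∫ w, φ (ip μ (f w.1 w.2)) ∂(D.prod D)| ≤ L := by
    intro μ hμ
    have := norm_integral_le_of_norm_le_const (μ := D.prod D)
      (f := fun w => φ (ip μ (f w.1 w.2)))
      (Filter.Eventually.of_forall fun w => hM μ hμ w.1 w.2)
    simpa using this
  have hU : ∀ μ ∈ T, ∀ S : Fin (m + m) → W, |ustat (fun w w' => φ (ip μ (f w w'))) S| ≤ L := by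
    intro μ hμ S
    rw [abs_le]
    constructor
    · rw [← ustat_const (by omega : 2 ≤ m + m) (-L) S]
      exact ustat_mono (by omega) (fun w w' => (abs_le.1 (hM μ hμ w w')).1) S
    · rw [← ustat_const (by omega : 2 ≤ m + m) L S]
      exact ustat_mono (by omega) (fun w w' => (abs_le.1 (hM μ hμ w w')).2) S
  have hFi : Integrable F P := by
    refine integrable_exp_sup P hT (F := fun μ S => t * (m * (∫ w, φ (ip μ (f w.1 w.2))
        ∂(D.prod D) - ustat (fun w w' => φ (ip μ (f w w'))) S))) (C := t * (m * (2 * L)))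
      (fun μ => ((measurable_const.sub (measurable_ustat (hg μ))).const_mul _).const_mul _) ?_
    intro μ hμ S
    rw [abs_mul, abs_mul, abs_of_pos htpos, abs_of_pos hm']
    have h := (abs_sub (∫ w, φ (ip μ (f w.1 w.2)) ∂(D.prod D))
      (ustat (fun w w' => φ (ip μ (f w w'))) S)).trans
      (add_le_add (hmeanM μ hμ) (hU μ hμ S))
    gcongr
    linarith
  have hmk := mul_meas_ge_le_integral_of_nonneg
    (Filter.Eventually.of_forall fun S => (Real.exp_pos _).le : 0 ≤ᵐ[P] F) hFi
    (Real.exp (t * (m * c)))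
  have hsub : {S | ∃ μ ∈ T, c ≤ ∫ w, φ (ip μ (f w.1 w.2)) ∂(D.prod D) -
      ustat (fun w w' => φ (ip μ (f w w'))) S} ⊆ {S | Real.exp (t * (m * c)) ≤ F S} := by
    rintro S ⟨μ, hμ, h⟩
    refine Real.exp_le_exp.2 (le_trans ?_ (Finset.le_sup' (fun μ =>
      t * (m * (∫ w, φ (ip μ (f w.1 w.2)) ∂(D.prod D) -
        ustat (fun w w' => φ (ip μ (f w w'))) S))) hμ))
    gcongr
  refine (measureReal_mono hsub).trans ?_
  rw [← mul_le_mul_iff_right₀ (Real.exp_pos (t * (m * c)))]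
  refine (hmk.trans hI).trans (le_of_eq ?_)
  rw [mul_left_comm, ← Real.exp_add]
  congr 2
  rw [ht]
  field_simp
  ring

end UStatistic

lemma l1norm_nonneg {p : ℕ} (μ : Fin p → ℝ) : 0 ≤ l1norm μ :=
  Finset.sum_nonneg fun _ _ => abs_nonneg _

/-- Finite nets of `ℓ¹`-balls. -/
lemma exists_finset_l1_net (p : ℕ) {B η : ℝ} (hB : 0 < B) (hη : 0 < η) :
    ∃ T : Finset (Fin p → ℝ), T.Nonempty ∧ (∀ μ ∈ T, l1norm μ ≤ B) ∧
      ∀ μ, l1norm μ ≤ B → ∃ ν ∈ T, l1norm (μ - ν) ≤ η := by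
  have hbdd : Bornology.IsBounded {μ : Fin p → ℝ | l1norm μ ≤ B} := by
    refine (Metric.isBounded_closedBall (x := (0 : Fin p → ℝ)) (r := B)).subset fun μ hμ => ?_
    rw [mem_closedBall_zero_iff, pi_norm_le_iff_of_nonneg hB.le]
    intro i
    exact (Finset.single_le_sum (f := fun i => |μ i|) (fun _ _ => abs_nonneg _)
      (Finset.mem_univ i)).trans hμ
  obtain ⟨t, hts, htf, hcov⟩ := Metric.finite_approx_of_totallyBounded
    (hbdd.isCompact_closure.totallyBounded.subset subset_closure) (η / (p + 1)) (by positivity)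
  have hnet : ∀ μ, l1norm μ ≤ B → ∃ ν ∈ htf.toFinset, l1norm (μ - ν) ≤ η := by
    intro μ hμ
    obtain ⟨ν, hν, hd⟩ := Set.mem_iUnion₂.1 (hcov hμ)
    refine ⟨ν, htf.mem_toFinset.2 hν, ?_⟩
    rw [Metric.mem_ball, dist_eq_norm] at hd
    calc l1norm (μ - ν) ≤ ∑ _i : Fin p, η / (p + 1) :=
          Finset.sum_le_sum fun i _ => (norm_le_pi_norm (μ - ν) i).trans hd.le
      _ = p * (η / (p + 1)) := by simp
      _ = η * (p / (p + 1)) := by ring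
      _ ≤ η * 1 := by
          gcongr
          rw [div_le_one (by positivity)]
          linarith
      _ = η := mul_one η
  refine ⟨htf.toFinset, ?_, fun μ hμ => hts (htf.mem_toFinset.1 hμ), hnet⟩
  obtain ⟨ν, hν, -⟩ := hnet 0 (by simpa [l1norm] using hB.le)
  exact ⟨ν, hν⟩

/-- The hinge function shifted to vanish at the origin. -/
def shiftedHinge (x : ℝ) : ℝ := max 0 (1 - x) - 1

lemma abs_shiftedHinge_sub_le (a b : ℝ) : |shiftedHinge a - shiftedHinge b| ≤ |a - b| := by
  have h := abs_max_sub_max_le_abs (1 - a) (1 - b) 0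
  rw [max_comm _ 0, max_comm _ 0] at h
  have e : 1 - a - (1 - b) = -(a - b) := by ring
  rw [e, abs_neg] at h
  simpa [shiftedHinge] using h

lemma shiftedHinge_zero : shiftedHinge 0 = 0 := by simp [shiftedHinge]

lemma abs_sgn (b : Bool) : |sgn b| = 1 := by cases b <;> simp [sgn]

lemma measurable_sgn : Measurable sgn := measurable_of_finite _

section Hinge

variable {X : Type*} {p : ℕ}

/-- The label-weighted feature vector `y y' z(x, x')`. -/
def labeledFeature (K : Fin p → X → X → ℝ) (w w' : X × Bool) : Fin p → ℝ :=
  fun i => sgn w.2 * sgn w'.2 * K i w.1 w'.1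

lemma hinge_eq (K : Fin p → X → X → ℝ) (μ : Fin p → ℝ) (w w' : X × Bool) :
    hinge K μ w w' = 1 + shiftedHinge (ip μ (labeledFeature K w w')) := by
  have : ip μ (labeledFeature K w w') = sgn w.2 * sgn w'.2 * ip μ (zmap K w.1 w'.1) := by
    simp only [ip, labeledFeature, zmap, Finset.mul_sum]
    exact Finset.sum_congr rfl fun i _ => by ring
  rw [hinge, this, shiftedHinge]
  ring

lemma abs_labeledFeature_le {K : Fin p → X → X → ℝ} {κ : ℝ} (hK : ∀ i x x', |K i x x'| ≤ κ)
    (w w' : X × Bool) (i : Fin p) : |labeledFeature K w w' i| ≤ κ := by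
  rw [labeledFeature, abs_mul, abs_mul, abs_sgn, abs_sgn, one_mul, one_mul]
  exact hK i _ _

lemma hinge_le_hinge_add {K : Fin p → X → X → ℝ} {κ : ℝ} (hK : ∀ i x x', |K i x x'| ≤ κ)
    (μ ν : Fin p → ℝ) (w w' : X × Bool) :
    hinge K μ w w' ≤ hinge K ν w w' + l1norm (μ - ν) * κ := by
  rw [hinge_eq, hinge_eq]
  have h1 := (le_abs_self _).trans (abs_shiftedHinge_sub_le (ip μ (labeledFeature K w w'))
    (ip ν (labeledFeature K w w')))
  have h2 : ip μ (labeledFeature K w w') - ip ν (labeledFeature K w w') =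
      ip (μ - ν) (labeledFeature K w w') := by
    simp [ip, sub_mul]
  rw [h2] at h1
  linarith [abs_ip_le (μ - ν) (abs_labeledFeature_le hK w w')]

lemma empRisk_eq_ustat {n : ℕ} (K : Fin p → X → X → ℝ) (S : Fin n → X × Bool) (μ : Fin p → ℝ) :
    empRisk K S μ = ustat (hinge K μ) S := rfl

lemma empRisk_eq {n : ℕ} (hn : 2 ≤ n) (K : Fin p → X → X → ℝ) (S : Fin n → X × Bool)
    (μ : Fin p → ℝ) : empRisk K S μ =
      1 + ustat (fun w w' => shiftedHinge (ip μ (labeledFeature K w w'))) S := by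
  have : hinge K μ = fun w w' => 1 + shiftedHinge (ip μ (labeledFeature K w w')) :=
    funext₂ (hinge_eq K μ)
  rw [empRisk_eq_ustat, this, ustat_add (fun _ _ => 1), ustat_const hn]

lemma empRisk_nonneg {n : ℕ} (hn : 2 ≤ n) (K : Fin p → X → X → ℝ) (S : Fin n → X × Bool)
    (μ : Fin p → ℝ) : 0 ≤ empRisk K S μ := by
  have h := ustat_mono hn (g := fun _ _ => 0) (g' := hinge K μ) (fun _ _ => le_max_left _ _) S
  rwa [ustat_const hn] at h

lemma empRisk_zero {n : ℕ} (hn : 2 ≤ n) (K : Fin p → X → X → ℝ) (S : Fin n → X × Bool) :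
    empRisk K S 0 = 1 := by
  have : (hinge K 0) = fun _ _ => 1 := by
    ext w w'
    simp [hinge, ip]
  rw [empRisk_eq_ustat, this, ustat_const hn]

lemma empRisk_le_add {n : ℕ} (hn : 2 ≤ n) {K : Fin p → X → X → ℝ} {κ : ℝ}
    (hK : ∀ i x x', |K i x x'| ≤ κ) (S : Fin n → X × Bool) (μ ν : Fin p → ℝ) :
    empRisk K S μ ≤ empRisk K S ν + l1norm (μ - ν) * κ := by
  rw [empRisk_eq_ustat, empRisk_eq_ustat, ← ustat_const hn (l1norm (μ - ν) * κ) S, ← ustat_add]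
  exact ustat_mono hn (hinge_le_hinge_add hK μ ν) S

variable [MeasurableSpace X]

lemma measurable_labeledFeature {K : Fin p → X → X → ℝ}
    (hK : ∀ i, Measurable fun w : X × X => K i w.1 w.2) (i : Fin p) :
    Measurable fun w : (X × Bool) × (X × Bool) => labeledFeature K w.1 w.2 i :=
  ((measurable_sgn.comp measurable_fst.snd).mul (measurable_sgn.comp measurable_snd.snd)).mul
    ((hK i).comp (f := fun w : (X × Bool) × (X × Bool) => (w.1.1, w.2.1))
      (measurable_fst.fst.prodMk measurable_snd.fst))

lemma integrable_shiftedHinge {K : Fin p → X → X → ℝ} {κ : ℝ}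
    (hKm : ∀ i, Measurable fun w : X × X => K i w.1 w.2) (hK : ∀ i x x', |K i x x'| ≤ κ)
    (D : Measure (X × Bool)) [IsProbabilityMeasure D] (μ : Fin p → ℝ) :
    Integrable (fun w => shiftedHinge (ip μ (labeledFeature K w.1 w.2))) (D.prod D) := by
  have hm : Measurable shiftedHinge := by unfold shiftedHinge; fun_prop
  refine Integrable.of_bound (hm.comp (Finset.measurable_sum _ fun i _ =>
    (measurable_labeledFeature hKm i).const_mul _)).aestronglyMeasurable (l1norm μ * κ)
    (Filter.Eventually.of_forall fun w => ?_)
  have h := abs_shiftedHinge_sub_le (ip μ (labeledFeature K w.1 w.2)) 0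
  rw [shiftedHinge_zero, sub_zero, sub_zero] at h
  exact h.trans (abs_ip_le μ (abs_labeledFeature_le hK w.1 w.2))

lemma integrable_hinge {K : Fin p → X → X → ℝ} {κ : ℝ}
    (hKm : ∀ i, Measurable fun w : X × X => K i w.1 w.2) (hK : ∀ i x x', |K i x x'| ≤ κ)
    (D : Measure (X × Bool)) [IsProbabilityMeasure D] (μ : Fin p → ℝ) :
    Integrable (fun w => hinge K μ w.1 w.2) (D.prod D) := by
  simp only [hinge_eq]
  exact (integrable_const _).add (integrable_shiftedHinge hKm hK D μ)

lemma trueRisk_eq {K : Fin p → X → X → ℝ} {κ : ℝ}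
    (hKm : ∀ i, Measurable fun w : X × X => K i w.1 w.2) (hK : ∀ i x x', |K i x x'| ≤ κ)
    (D : Measure (X × Bool)) [IsProbabilityMeasure D] (μ : Fin p → ℝ) :
    trueRisk K D μ =
      1 + ∫ w, shiftedHinge (ip μ (labeledFeature K w.1 w.2)) ∂(D.prod D) := by
  simp only [trueRisk, hinge_eq]
  rw [integral_add (integrable_const _) (integrable_shiftedHinge hKm hK D μ)]
  simp

lemma trueRisk_le_add {K : Fin p → X → X → ℝ} {κ : ℝ}
    (hKm : ∀ i, Measurable fun w : X × X => K i w.1 w.2) (hK : ∀ i x x', |K i x x'| ≤ κ)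
    (D : Measure (X × Bool)) [IsProbabilityMeasure D] (μ ν : Fin p → ℝ) :
    trueRisk K D μ ≤ trueRisk K D ν + l1norm (μ - ν) * κ := by
  have h : trueRisk K D ν + l1norm (μ - ν) * κ =
      ∫ w, (hinge K ν w.1 w.2 + l1norm (μ - ν) * κ) ∂(D.prod D) := by
    rw [integral_add (integrable_hinge hKm hK D ν) (integrable_const _)]
    simp [trueRisk]
  rw [h]
  exact integral_mono (integrable_hinge hKm hK D μ)
    ((integrable_hinge hKm hK D ν).add (integrable_const _))
    fun w => hinge_le_hinge_add hK μ ν w.1 w.2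

end Hinge

/-- The deterministic part of the oracle inequality: uniform control of the risk on a net and
control of the empirical risk of the oracle imply the risk bound for regularized minimizers. -/
lemma trueRisk_le_of_net_deviation {X : Type*} [MeasurableSpace X] {p n : ℕ} (hn : 2 ≤ n)
    {K : Fin p → X → X → ℝ} {κ : ℝ} (hκ : 0 < κ)
    (hKm : ∀ i, Measurable fun w : X × X => K i w.1 w.2) (hK : ∀ i x x', |K i x x'| ≤ κ)
    (D : Measure (X × Bool)) [IsProbabilityMeasure D] {μo : Fin p → ℝ} {εo ε₁ : ℝ}
    (hμo : ∀ i, 0 ≤ μo i) (hl1 : 0 < l1norm μo) (hrisk : trueRisk K D μo ≤ εo) (hε : 0 < ε₁)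
    {T : Finset (Fin p → ℝ)} (hnet : ∀ μ, l1norm μ ≤ 3 * l1norm μo / ε₁ →
      ∃ ν ∈ T, l1norm (μ - ν) ≤ ε₁ / (24 * κ))
    {S : Fin n → X × Bool} (hT : ∀ μ ∈ T, trueRisk K D μ ≤ empRisk K S μ + ε₁ / 4)
    (ho : empRisk K S μo ≤ trueRisk K D μo + ε₁ / 4) {muh : Fin p → ℝ}
    (hmin : ∀ μ : Fin p → ℝ, (∀ i, 0 ≤ μ i) →
      (2 * ε₁ / (3 * l1norm μo)) / 2 * l1norm muh + empRisk K S muh ≤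
        (2 * ε₁ / (3 * l1norm μo)) / 2 * l1norm μ + empRisk K S μ) :
    trueRisk K D muh ≤ εo + ε₁ := by
  have hlam : (2 * ε₁ / (3 * l1norm μo)) / 2 = ε₁ / (3 * l1norm μo) := by field_simp
  simp only [hlam] at hmin
  have hball : l1norm muh ≤ 3 * l1norm μo / ε₁ := by
    have h := hmin 0 fun _ => le_rfl
    have h0 : l1norm (0 : Fin p → ℝ) = 0 := by simp [l1norm]
    rw [h0, empRisk_zero hn] at h
    have h' : ε₁ / (3 * l1norm μo) * l1norm muh ≤ 1 := by
      linarith [empRisk_nonneg hn K S muh]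
    rw [le_div_iff₀ hε]
    rw [div_mul_eq_mul_div, div_le_one (by positivity)] at h'
    linarith
  obtain ⟨ν, hν, hd⟩ := hnet muh hball
  have hdκ : l1norm (muh - ν) * κ ≤ ε₁ / 24 := by
    calc _ ≤ ε₁ / (24 * κ) * κ := mul_le_mul_of_nonneg_right hd hκ.le
      _ = _ := by field_simp
  have hsymm : l1norm (ν - muh) = l1norm (muh - ν) :=
    Finset.sum_congr rfl fun i _ => abs_sub_comm _ _
  have h1 := trueRisk_le_add hKm hK D muh ν
  have h2 := empRisk_le_add hn hK S ν muh
  rw [hsymm] at h2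
  have h3 := hmin μo hμo
  have h4 : ε₁ / (3 * l1norm μo) * l1norm μo = ε₁ / 3 := by field_simp
  have h5 : 0 ≤ ε₁ / (3 * l1norm μo) * l1norm muh :=
    mul_nonneg (by positivity) (l1norm_nonneg muh)
  linarith [hT ν hν]

lemma tail_le_of_sample_size {p n m : ℕ} (hp : 3 ≤ p) (hnm : n = m + m) {A ε₁ δ : ℝ} (hA : 0 < A)
    (hε : 0 < ε₁) (hδ : 0 < δ) (hδ1 : δ ≤ 1)
    (hn : 4608 * A ^ 2 * (Real.sqrt (Real.log p) + Real.sqrt (Real.log (1 / δ))) ^ 2 / ε₁ ^ 4 ≤ n) :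
    2 * p * Real.exp (-((ε₁ / 4) ^ 2 * m / (8 * (3 * A / ε₁) ^ 2))) ≤ δ := by
  have hp' : (3 : ℝ) ≤ p := by exact_mod_cast hp
  have hlp : 0 ≤ Real.log p := Real.log_nonneg (by linarith)
  have hld : 0 ≤ Real.log (1 / δ) := Real.log_nonneg (by rw [le_div_iff₀ hδ]; linarith)
  have hm : (n : ℝ) = 2 * m := by rw [hnm]; push_cast; ring
  have hsq : Real.log p + Real.log (1 / δ) ≤
      (Real.sqrt (Real.log p) + Real.sqrt (Real.log (1 / δ))) ^ 2 := by
    rw [add_sq, Real.sq_sqrt hlp, Real.sq_sqrt hld]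
    have := mul_nonneg (Real.sqrt_nonneg (Real.log p)) (Real.sqrt_nonneg (Real.log (1 / δ)))
    linarith
  have hexp : 2 * (Real.log p + Real.log (1 / δ)) ≤
      (ε₁ / 4) ^ 2 * m / (8 * (3 * A / ε₁) ^ 2) := by
    have e : (ε₁ / 4) ^ 2 * m / (8 * (3 * A / ε₁) ^ 2) = n * ε₁ ^ 4 / (2304 * A ^ 2) := by
      rw [hm]; field_simp; ring
    rw [e, le_div_iff₀ (by positivity)]
    rw [div_le_iff₀ (by positivity)] at hn
    refine le_trans ?_ hn
    have := mul_le_mul_of_nonneg_left hsq (by positivity : 0 ≤ 4608 * A ^ 2)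
    linarith
  have hval : Real.exp (-(2 * (Real.log p + Real.log (1 / δ)))) = δ ^ 2 / p ^ 2 := by
    rw [Real.log_div one_ne_zero hδ.ne', Real.log_one, zero_sub]
    have : -(2 * (Real.log p + -Real.log δ)) = Real.log (δ ^ 2 / p ^ 2) := by
      rw [Real.log_div (by positivity) (by positivity), Real.log_pow, Real.log_pow]
      push_cast; ring
    rw [this, Real.exp_log (by positivity)]
  calc _ ≤ 2 * p * Real.exp (-(2 * (Real.log p + Real.log (1 / δ)))) := by gcongr
    _ = (2 / p) * (δ * δ) := by rw [hval]; field_simp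
    _ ≤ 1 * (1 * δ) := by
        gcongr
        rw [div_le_one (by linarith)]
        linarith
    _ = δ := by ring

lemma ofReal_one_sub_le_of_measureReal_le {Ω : Type*} [MeasurableSpace Ω] (P : Measure Ω)
    [IsProbabilityMeasure P] {E : Set Ω} {c : ℝ} (h : P.real E ≤ c) :
    ENNReal.ofReal (1 - c) ≤ P Eᶜ := by
  have h1 : P.real Set.univ ≤ P.real E + P.real Eᶜ := by
    rw [← Set.union_compl_self E]
    exact measureReal_union_le E Eᶜ
  rw [probReal_univ] at h1
  rw [← ofReal_measureReal (measure_ne_top P Eᶜ)]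
  exact ENNReal.ofReal_le_ofReal (by linarith)

/-- oracle inequality for L1-regularized (sparse) two-stage MKL: with a
suitable universal constant C, sample size
n ≥ C‖μ_o‖₁²‖κ‖_∞²(√log p + √log(1/δ))²/ε₁⁴ and λ = 2ε₁/(3‖μ_o‖₁), the regularized
ERM is (ε_o + ε₁)-combination good with probability ≥ 1 − 2δ. -/
theorem stmt16 :
    ∃ C : ℝ, 0 < C ∧
      ∀ (X : Type) [MeasurableSpace X] (p : ℕ), 3 ≤ p →
        ∀ (K : Fin p → X → X → ℝ),
        (∀ i, Measurable (fun w : X × X => K i w.1 w.2)) →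
        ∀ (κ : Fin p → ℝ), (∀ i, 0 < κ i) → (∀ i x x', |K i x x'| ≤ κ i ^ 2) →
        ∀ (D : Measure (X × Bool)), IsProbabilityMeasure D →
        ∀ (μo : Fin p → ℝ) (εo : ℝ), (∀ i, 0 ≤ μo i) → μo ≠ 0 →
          trueRisk K D μo ≤ εo →
        ∀ (ε₁ δ : ℝ), 0 < ε₁ → ε₁ < 3 / 4 → 0 < δ → δ ≤ 1 / Real.exp 1 →
        ∀ (n : ℕ), Even n →
          C * l1norm μo ^ 2 * linfnorm (fun i => κ i ^ 2) ^ 2 *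
              (Real.sqrt (Real.log p) + Real.sqrt (Real.log (1 / δ))) ^ 2 / ε₁ ^ 4
            ≤ (n : ℝ) →
          ENNReal.ofReal (1 - 2 * δ) ≤
            (Measure.pi fun _ : Fin n => D) {S | ∀ muh : Fin p → ℝ, (∀ i, 0 ≤ muh i) →
              (∀ μ : Fin p → ℝ, (∀ i, 0 ≤ μ i) →
                (2 * ε₁ / (3 * l1norm μo)) / 2 * l1norm muh + empRisk K S muh ≤
                  (2 * ε₁ / (3 * l1norm μo)) / 2 * l1norm μ + empRisk K S μ) →
              trueRisk K D muh ≤ εo + ε₁} := by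
  refine ⟨4608, by norm_num, ?_⟩
  intro X _ p hp K hKm κ hκ hKκ D hD μo εo hμo hμ0 hrisk ε₁ δ hε hε34 hδ hδe n hn hsize
  have : NeZero p := ⟨by omega⟩
  have hp' : (3 : ℝ) ≤ p := by exact_mod_cast hp
  have hδ1 : δ ≤ 1 := hδe.trans (by
    rw [div_le_one (Real.exp_pos 1)]
    linarith [Real.add_one_le_exp (1 : ℝ)])
  set N := linfnorm fun i => κ i ^ 2 with hN
  have hκN : ∀ i, κ i ^ 2 ≤ N := fun i =>
    (le_abs_self _).trans (le_ciSup (Set.finite_range fun i => |κ i ^ 2|).bddAbove i)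
  have hNpos : 0 < N := (pow_pos (hκ 0) 2).trans_le (hκN 0)
  have hKN : ∀ i x x', |K i x x'| ≤ N := fun i x x' => (hKκ i x x').trans (hκN i)
  have hl1 : 0 < l1norm μo := by
    obtain ⟨i, hi⟩ := Function.ne_iff.1 hμ0
    exact (abs_pos.2 hi).trans_le (Finset.single_le_sum (f := fun i => |μo i|)
      (fun _ _ => abs_nonneg _) (Finset.mem_univ i))
  have hnpos : 0 < n := by
    have hlog : 0 < Real.sqrt (Real.log p) := Real.sqrt_pos.2 (Real.log_pos (by linarith))
    have hs : 0 < Real.sqrt (Real.log p) + Real.sqrt (Real.log (1 / δ)) :=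
      add_pos_of_pos_of_nonneg hlog (Real.sqrt_nonneg _)
    have : (0 : ℝ) < n := lt_of_lt_of_le (by positivity) hsize
    exact_mod_cast this
  obtain ⟨m, rfl⟩ := hn
  have hm : 0 < m := by omega
  have hn2 : 2 ≤ m + m := by omega
  have htail := tail_le_of_sample_size (A := l1norm μo * N) hp rfl (by positivity) hε hδ hδ1
    (by rw [mul_pow, ← mul_assoc]; exact hsize)
  have hB : 0 < 3 * l1norm μo / ε₁ := by positivity
  have hBN : 3 * l1norm μo / ε₁ * N = 3 * (l1norm μo * N) / ε₁ := by ring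
  obtain ⟨T, hT, hTB, hnet⟩ := exists_finset_l1_net p hB (by positivity : 0 < ε₁ / (24 * N))
  have hdev := measure_ustat_deviation_le D hm hT hB hNpos (by positivity : 0 < ε₁ / 4) hTB
    (measurable_labeledFeature hKm) (abs_labeledFeature_le hKN) abs_shiftedHinge_sub_le
    shiftedHinge_zero
  have hoB : ∀ μ ∈ ({μo} : Finset (Fin p → ℝ)), l1norm μ ≤ 3 * l1norm μo / ε₁ := by
    intro μ hμ
    rw [Finset.mem_singleton.1 hμ, le_div_iff₀ hε]
    nlinarith
  have hdevo := measure_ustat_deviation_le D hm (Finset.singleton_nonempty μo) hB hNpos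
    (by positivity : 0 < ε₁ / 4) hoB
    (measurable_labeledFeature hKm) (abs_labeledFeature_le hKN) (φ := fun x => -shiftedHinge x)
    (fun a b => by
      rw [neg_sub_neg, abs_sub_comm]
      exact abs_shiftedHinge_sub_le a b) (by simp [shiftedHinge_zero])
  rw [hBN] at hdev hdevo
  set P := Measure.pi fun _ : Fin (m + m) => D
  set E := {S : Fin (m + m) → X × Bool | ∃ μ ∈ T, ε₁ / 4 ≤
    ∫ w, shiftedHinge (ip μ (labeledFeature K w.1 w.2)) ∂(D.prod D) -
      ustat (fun w w' => shiftedHinge (ip μ (labeledFeature K w w'))) S}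
  set Eo := {S : Fin (m + m) → X × Bool | ∃ μ ∈ ({μo} : Finset (Fin p → ℝ)), ε₁ / 4 ≤
    ∫ w, -shiftedHinge (ip μ (labeledFeature K w.1 w.2)) ∂(D.prod D) -
      ustat (fun w w' => -shiftedHinge (ip μ (labeledFeature K w w'))) S}
  have hbad : P.real (E ∪ Eo) ≤ 2 * δ := by
    linarith [measureReal_union_le (μ := P) E Eo]
  refine (ofReal_one_sub_le_of_measureReal_le P hbad).trans (measure_mono fun S hS => ?_)
  rw [Set.mem_compl_iff, Set.mem_union, not_or] at hS
  intro muh _ hmin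
  refine trueRisk_le_of_net_deviation hn2 hNpos hKm hKN D hμo hl1 hrisk hε hnet ?_ ?_ hmin
  · intro μ hμ
    have h : ¬ _ := fun h => hS.1 ⟨μ, hμ, h⟩
    rw [trueRisk_eq hKm hKN, empRisk_eq hn2]
    linarith [not_le.1 h]
  · have h : ¬ _ := fun h => hS.2 ⟨μo, Finset.mem_singleton_self μo, h⟩
    rw [integral_neg, ustat_neg] at h
    rw [trueRisk_eq hKm hKN, empRisk_eq hn2]
    linarith [not_le.1 h]
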